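/- An inverse semigroup S is fundamental if and only if the centralizer of E(S) in S equals E(S); that is, the relation μ is the equality relation if and only if every element of S that commutes with every idempotent of S is itself an idempotent. -/

import Mathlib

/-- An inverse semigroup: every element has a unique inverse. -/
class InverseSemigroup (S : Type*) extends Semigroup S, Inv S where
  mul_inv_mul : ∀ a : S, a * a⁻¹ * a = a
  inv_mul_inv : ∀ a : S, a⁻¹ * a * a⁻¹ = a⁻¹
  inv_unique : ∀ a b : S, a * b * a = a → b * a * b = b → b = a⁻¹

/-- `a` is an idempotent. -/
def IsIdem {S : Type*} [Mul S] (a : S) : Prop := a * a = a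

/-- The natural partial order on an inverse semigroup: `a ≤ b` iff `a = b * e`
for some idempotent `e`. -/
def natLe {S : Type*} [InverseSemigroup S] (a b : S) : Prop :=
  ∃ e : S, IsIdem e ∧ a = b * e

/-- `a` and `b` are compatible: both `a⁻¹ * b` and `a * b⁻¹` are idempotents. -/
def Compatible {S : Type*} [InverseSemigroup S] (a b : S) : Prop :=
  IsIdem (a⁻¹ * b) ∧ IsIdem (a * b⁻¹)

/-- `c` is the least upper bound of `{a, b}` with respect to the natural partial order. -/
def IsLubPair {S : Type*} [InverseSemigroup S] (a b c : S) : Prop :=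
  natLe a c ∧ natLe b c ∧ ∀ d : S, natLe a d → natLe b d → natLe c d

/-- The relation `μ`: `a μ b` iff `a⁻¹ * e * a = b⁻¹ * e * b` for every idempotent `e`. -/
def mu {S : Type*} [InverseSemigroup S] (a b : S) : Prop :=
  ∀ e : S, IsIdem e → a⁻¹ * e * a = b⁻¹ * e * b

namespace InverseSemigroup

variable {S : Type*} [InverseSemigroup S]

theorem inv_eq_self_of_isIdem {e : S} (he : IsIdem e) : e⁻¹ = e := by
  have h : e * e * e = e := by rw [he, he]
  exact (inv_unique e e h h).symm

theorem isIdem_inv_mul_self (a : S) : IsIdem (a⁻¹ * a) := by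
  unfold IsIdem
  rw [← mul_assoc, inv_mul_inv]

theorem isIdem_mul_inv_self (a : S) : IsIdem (a * a⁻¹) := by
  unfold IsIdem
  rw [← mul_assoc, mul_inv_mul]

theorem isIdem_mul {e f : S} (he : IsIdem e) (hf : IsIdem f) : IsIdem (e * f) := by
  unfold IsIdem at he hf
  have h₁ := mul_inv_mul (e * f)
  have h₂ := inv_mul_inv (e * f)
  have huniq := inv_unique (e * f) (f * (e * f)⁻¹ * e)
  have hinv := inv_unique (e * f)⁻¹ (e * f) h₂ h₁
  generalize (e * f)⁻¹ = x at *
  have hx : f * x * e = x := by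
    apply huniq
    · calc e * f * (f * x * e) * (e * f) = e * (f * f) * x * (e * e) * f := by
            simp only [mul_assoc]
        _ = e * f * x * (e * f) := by rw [he, hf]; simp only [mul_assoc]
        _ = e * f := h₁
    · calc f * x * e * (e * f) * (f * x * e) = f * x * (e * e) * (f * f) * x * e := by
            simp only [mul_assoc]
        _ = f * (x * (e * f) * x) * e := by rw [he, hf]; simp only [mul_assoc]
        _ = f * x * e := by rw [h₂]
  have hxx : IsIdem x := by
    unfold IsIdem
    calc x * x = f * x * e * (f * x * e) := by rw [hx]
      _ = f * (x * (e * f) * x) * e := by simp only [mul_assoc]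
      _ = x := by rw [h₂, hx]
  rw [hinv, inv_eq_self_of_isIdem hxx]
  exact hxx

theorem mul_comm_of_isIdem {e f : S} (he : IsIdem e) (hf : IsIdem f) : e * f = f * e := by
  have hef := isIdem_mul he hf
  have aux : ∀ {e f : S}, IsIdem e → IsIdem f → e * f * (f * e) * (e * f) = e * f := by
    intro e f he hf
    have hef := isIdem_mul he hf
    unfold IsIdem at he hf hef
    calc e * f * (f * e) * (e * f) = e * (f * f) * (e * e) * f := by simp only [mul_assoc]
      _ = e * f * (e * f) := by rw [he, hf]; simp only [mul_assoc]
      _ = e * f := hef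
  rw [inv_unique (e * f) (f * e) (aux he hf) (aux hf he), inv_eq_self_of_isIdem hef]

theorem mu_inv_mul_self_of_commute {s : S} (hs : ∀ e : S, IsIdem e → s * e = e * s) :
    mu s (s⁻¹ * s) := by
  intro e he
  have hi := isIdem_inv_mul_self s
  rw [inv_eq_self_of_isIdem hi, mul_assoc (s⁻¹ * s), mul_comm_of_isIdem he hi, ← mul_assoc, hi,
    mul_assoc, ← hs e he, mul_assoc]

theorem _root_.mu.symm {a b : S} (h : mu a b) : mu b a := fun e he => (h e he).symm

theorem _root_.mu.inv_mul_self_mul {a b : S} (h : mu a b) :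
    a⁻¹ * a * (b⁻¹ * b) = a⁻¹ * a := by
  have h₁ := h _ (isIdem_mul_inv_self a)
  rw [← mul_assoc, inv_mul_inv] at h₁
  rw [h₁, mul_assoc, ← mul_assoc b, mul_inv_mul]

theorem _root_.mu.inv_mul_self_eq {a b : S} (h : mu a b) : a⁻¹ * a = b⁻¹ * b := by
  rw [← h.inv_mul_self_mul,
    mul_comm_of_isIdem (isIdem_inv_mul_self a) (isIdem_inv_mul_self b), h.symm.inv_mul_self_mul]

theorem _root_.mu.mul_inv_commute {a b : S} (h : mu a b) {e : S} (he : IsIdem e) :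
    a * b⁻¹ * e = e * (a * b⁻¹) :=
  calc a * b⁻¹ * e = a * (b⁻¹ * b * b⁻¹) * e := by rw [inv_mul_inv]
    _ = a * b⁻¹ * (b * b⁻¹ * e) := by simp only [mul_assoc]
    _ = a * (b⁻¹ * e * b) * b⁻¹ := by
      rw [mul_comm_of_isIdem (isIdem_mul_inv_self b) he]; simp only [mul_assoc]
    _ = a * a⁻¹ * e * (a * b⁻¹) := by rw [← h e he]; simp only [mul_assoc]
    _ = e * (a * a⁻¹ * a) * b⁻¹ := by
      rw [mul_comm_of_isIdem (isIdem_mul_inv_self a) he]; simp only [mul_assoc]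
    _ = e * (a * b⁻¹) := by rw [mul_inv_mul, mul_assoc]

theorem _root_.mu.mul_inv_mul_eq {a b : S} (h : mu a b) : a * b⁻¹ * b = a := by
  rw [mul_assoc, ← h.inv_mul_self_eq, ← mul_assoc, mul_inv_mul]

theorem eq_of_isIdem_mul_eq {a b i j : S} (hi : IsIdem i) (hj : IsIdem j)
    (ha : i * b = a) (hb : j * a = b) : a = b :=
  calc a = i * (j * a) := by rw [hb, ha]
    _ = j * (i * a) := by rw [← mul_assoc, mul_comm_of_isIdem hi hj, mul_assoc]
    _ = j * (i * i * b) := by rw [mul_assoc, ha]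
    _ = b := by rw [hi, ha, hb]

end InverseSemigroup

/-- `S` is fundamental iff the centralizer of the idempotents consists of idempotents. -/
theorem statement6 {S : Type*} [InverseSemigroup S] :
    (∀ a b : S, mu a b → a = b) ↔
    ∀ s : S, (∀ e : S, IsIdem e → s * e = e * s) → IsIdem s := by
  constructor
  · intro h s hs
    rw [h _ _ (InverseSemigroup.mu_inv_mul_self_of_commute hs)]
    exact InverseSemigroup.isIdem_inv_mul_self s
  · intro h a b hab
    exact InverseSemigroup.eq_of_isIdem_mul_eq
      (h (a * b⁻¹) fun _ he => hab.mul_inv_commute he)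
      (h (b * a⁻¹) fun _ he => hab.symm.mul_inv_commute he)
      hab.mul_inv_mul_eq hab.symm.mul_inv_mul_eq
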